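/- Suppose exactly one change point v lies strictly between l and u, all means satisfy ‖μ_i‖ ≤ B, and M_u − M_l = 0. Then Θ_{l,u} = max_{l<k<u} ‖Θ_{l,u}^k‖ = ‖Θ_{l,u}^v‖ ≤ √2·B·√(min(v − l, u − v)). -/

import Mathlib

open Filter MeasureTheory ProbabilityTheory

/-- Partial sum `S_k = ∑_{j=1}^k x_j`. -/
noncomputable def psum {H : Type*} [AddCommMonoid H] (x : ℕ → H) (k : ℕ) : H :=
  ∑ j ∈ Finset.Icc 1 k, x j

/-- The (generalized) CUSUM process of the sequence `x` on the segment `(l, u]`: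
`𝒮_{l,u}^k = √((u−l)/((u−k)(k−l))) • [S_k − S_l − ((k−l)/(u−l)) (S_u − S_l)]`. -/
noncomputable def cusum {H : Type*} [NormedAddCommGroup H] [NormedSpace ℝ H]
    (x : ℕ → H) (l u k : ℕ) : H :=
  Real.sqrt (((u : ℝ) - l) / (((u : ℝ) - k) * ((k : ℝ) - l))) •
    (psum x k - psum x l - (((k : ℝ) - l) / ((u : ℝ) - l)) • (psum x u - psum x l))

theorem psum_sub_psum_of_forall_eq {H : Type*} [NormedAddCommGroup H] [NormedSpace ℝ H]
    {x : ℕ → H} {c : H} {l k : ℕ} (hlk : l ≤ k) (hx : ∀ i, l < i → i ≤ k → x i = c) :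
    psum x k - psum x l = ((k : ℝ) - l) • c := by
  induction k, hlk using Nat.le_induction with
  | base => simp
  | succ k hlk ih =>
    have hsum : psum x (k + 1) = psum x k + x (k + 1) :=
      Finset.sum_Icc_succ_top (by lia) x
    rw [hsum, add_sub_right_comm, ih fun i hi hik => hx i hi (by lia),
      hx (k + 1) (by lia) le_rfl]
    push_cast
    module

theorem norm_cusum_of_psum_eq {H : Type*} [NormedAddCommGroup H] [NormedSpace ℝ H]
    {x : ℕ → H} {l u : ℕ} (h : psum x u = psum x l) (k : ℕ) :
    ‖cusum x l u k‖ =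
      Real.sqrt (((u : ℝ) - l) / (((u : ℝ) - k) * ((k : ℝ) - l))) * ‖psum x k - psum x l‖ := by
  simp [cusum, h, norm_smul, abs_of_nonneg (Real.sqrt_nonneg _)]

theorem sqrt_div_mul_mul_self {n p q : ℝ} (hq : 0 < q) :
    Real.sqrt (n / (p * q)) * q = Real.sqrt (n * (q / p)) := by
  nth_rewrite 2 [← Real.sqrt_sq hq.le]
  rw [← Real.sqrt_mul' _ (sq_nonneg q)]
  congr 1
  field_simp

/-- Left of the change point the norm of the CUSUM is an explicit increasing function. -/
theorem norm_cusum_of_forall_eq_left {H : Type*} [NormedAddCommGroup H] [NormedSpace ℝ H]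
    {x : ℕ → H} {c : H} {l k u : ℕ} (h : psum x u = psum x l) (hlk : l < k)
    (hx : ∀ i, l < i → i ≤ k → x i = c) :
    ‖cusum x l u k‖ =
      Real.sqrt (((u : ℝ) - l) * (((k : ℝ) - l) / ((u : ℝ) - k))) * ‖c‖ := by
  have hpos : (0 : ℝ) < k - l := sub_pos.2 (Nat.cast_lt.2 hlk)
  rw [norm_cusum_of_psum_eq h, psum_sub_psum_of_forall_eq hlk.le hx, norm_smul,
    Real.norm_of_nonneg hpos.le, ← mul_assoc, sqrt_div_mul_mul_self hpos]

/-- Right of the change point the norm of the CUSUM is an explicit decreasing function. -/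
theorem norm_cusum_of_forall_eq_right {H : Type*} [NormedAddCommGroup H] [NormedSpace ℝ H]
    {x : ℕ → H} {c : H} {l k u : ℕ} (h : psum x u = psum x l) (hku : k < u)
    (hx : ∀ i, k < i → i ≤ u → x i = c) :
    ‖cusum x l u k‖ =
      Real.sqrt (((u : ℝ) - l) * (((u : ℝ) - k) / ((k : ℝ) - l))) * ‖c‖ := by
  have hpos : (0 : ℝ) < u - k := sub_pos.2 (Nat.cast_lt.2 hku)
  rw [norm_cusum_of_psum_eq h, ← h, norm_sub_rev, psum_sub_psum_of_forall_eq hku.le hx,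
    norm_smul, Real.norm_of_nonneg hpos.le, ← mul_assoc, mul_comm ((u : ℝ) - k),
    sqrt_div_mul_mul_self hpos]

theorem sqrt_add_mul_div_mul_le {p q c B : ℝ} (hp : 0 ≤ p) (hq : 0 < q) (hpq : p ≤ q)
    (hc : 0 ≤ c) (hcB : c ≤ B) :
    Real.sqrt ((p + q) * (p / q)) * c ≤ Real.sqrt 2 * B * Real.sqrt p := by
  rw [mul_right_comm, ← Real.sqrt_mul zero_le_two]
  have hle : (p + q) * (p / q) ≤ 2 * p := by
    rw [← mul_div_assoc, div_le_iff₀ hq]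
    nlinarith
  gcongr

/-- Case 2 of Lemma 6: with exactly one change point `v` strictly between `l` and `u`, means
bounded by `B`, and `M_u − M_l = 0`, the maximum of `‖Θ_{l,u}^k‖` over `l < k < u` is attained
at `v` and `‖Θ_{l,u}^v‖ ≤ √2 · B · √(min(v − l, u − v))`. -/
theorem signal_cusum_single_change_point_upper_bound
    {H : Type*} [NormedAddCommGroup H] [InnerProductSpace ℝ H]
    (um : ℕ → H) (μ μ' : H) (l v u : ℕ)
    (hlv : l < v) (hvu : v < u)
    (hmean₁ : ∀ i, l < i → i ≤ v → um i = μ)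
    (hmean₂ : ∀ i, v < i → i ≤ u → um i = μ')
    (B : ℝ) (hμ : ‖μ‖ ≤ B) (hμ' : ‖μ'‖ ≤ B)
    (hM : psum um u = psum um l) :
    (∀ k, l < k → k < u → ‖cusum um l u k‖ ≤ ‖cusum um l u v‖) ∧
    ‖cusum um l u v‖ ≤ Real.sqrt 2 * B * Real.sqrt ((min (v - l) (u - v) : ℕ) : ℝ) := by
  refine ⟨fun k hlk hku => ?_, ?_⟩
  · have hlu : (l : ℝ) ≤ u := by exact_mod_cast (hlv.trans hvu).le
    have hlv' : (l : ℝ) < v := by exact_mod_cast hlv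
    have hvu' : (v : ℝ) < u := by exact_mod_cast hvu
    rcases le_total k v with hkv | hvk
    · rw [norm_cusum_of_forall_eq_left hM hlk fun i hi hik => hmean₁ i hi (hik.trans hkv),
        norm_cusum_of_forall_eq_left hM hlv hmean₁]
      have hkv' : (k : ℝ) ≤ v := by exact_mod_cast hkv
      gcongr
    · rw [norm_cusum_of_forall_eq_right hM hku fun i hi hiu => hmean₂ i (hvk.trans_lt hi) hiu,
        norm_cusum_of_forall_eq_right hM hvu hmean₂]
      have hvk' : (v : ℝ) ≤ k := by exact_mod_cast hvk
      gcongr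
  · have hp : (0 : ℝ) < v - l := sub_pos.2 (Nat.cast_lt.2 hlv)
    have hq : (0 : ℝ) < u - v := sub_pos.2 (Nat.cast_lt.2 hvu)
    rw [Nat.cast_min, Nat.cast_sub hlv.le, Nat.cast_sub hvu.le]
    rcases le_total ((v : ℝ) - l) (u - v) with hpq | hqp
    · rw [min_eq_left hpq, norm_cusum_of_forall_eq_left hM hlv hmean₁,
        show (u : ℝ) - l = (v - l) + (u - v) by ring]
      exact sqrt_add_mul_div_mul_le hp.le hq hpq (norm_nonneg μ) hμ
    · rw [min_eq_right hqp, norm_cusum_of_forall_eq_right hM hvu hmean₂,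
        show (u : ℝ) - l = (u - v) + (v - l) by ring]
      exact sqrt_add_mul_div_mul_le hq.le hp hqp (norm_nonneg μ') hμ'
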